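/- With this setup, both the number of indices j ∈ Fin n with a(j) < m and the number of indices j with a(j) ≥ m are at most ⌊(7n+20)/10⌋; hence after partitioning by comparison with m, at most ⌊(7n+20)/10⌋ elements remain in either recursive branch of the k-selection algorithm. -/

import Mathlib

theorem Finset.card_filter_lt_add_one_le {α : Type*} [LinearOrder α] {S : Finset α} {p m : α}
    (hp : p ∈ S) (hpm : p < m) :
    (S.filter (fun x => x < p)).card + 1 ≤ (S.filter (fun x => x < m)).card := by
  refine Finset.card_lt_card (Finset.ssubset_iff_of_subset ?_ |>.2 ⟨p, by simp [hp, hpm], by simp⟩)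
  exact Finset.monotone_filter_right S fun x _ hx => lt_trans hx hpm

theorem Finset.card_filter_lt_le_of_le {α : Type*} [LinearOrder α] (S : Finset α) {p m : α}
    (hmp : m ≤ p) :
    (S.filter (fun x => x < m)).card ≤ (S.filter (fun x => x < p)).card :=
  Finset.card_le_card (Finset.monotone_filter_right S fun _ _ hx => lt_of_lt_of_le hx hmp)

theorem Fin.card_filter_le_and_lt (n l u : ℕ) (hu : u ≤ n) :
    (Finset.univ.filter (fun j : Fin n => l ≤ (j : ℕ) ∧ (j : ℕ) < u)).card = u - l := by
  rw [← Nat.card_Ico, ← Finset.card_map Fin.valEmbedding]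
  congr 1
  ext x
  simp only [Finset.mem_map, Finset.mem_filter, Finset.mem_univ, true_and,
    Fin.valEmbedding_apply, Finset.mem_Ico]
  exact ⟨fun ⟨j, hj, hx⟩ => hx ▸ hj, fun hx => ⟨⟨x, by omega⟩, hx, rfl⟩⟩

/-- Splitting the indices into blocks of five splits the count of indices satisfying `P`. -/
theorem Fin.card_filter_eq_sum_blocks (n : ℕ) (P : Fin n → Prop) [DecidablePred P] :
    (Finset.univ.filter P).card = ∑ i ∈ Finset.range ((n + 4) / 5),
      ((Finset.univ.filter (fun j : Fin n =>
        5 * i ≤ (j : ℕ) ∧ (j : ℕ) < min (5 * (i + 1)) n)).filter P).card := by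
  rw [Finset.card_eq_sum_card_fiberwise (f := fun j : Fin n => (j : ℕ) / 5)
    (t := Finset.range ((n + 4) / 5))]
  · refine Finset.sum_congr rfl fun i _ => congrArg Finset.card ?_
    ext j
    have := j.2
    simp only [Finset.mem_filter, Finset.mem_univ, true_and, lt_min_iff]
    constructor
    · rintro ⟨hP, h⟩
      exact ⟨by omega, hP⟩
    · rintro ⟨h, hP⟩
      exact ⟨hP, by omega⟩
  · intro j _
    have := j.2
    simp only [Finset.coe_range, Set.mem_Iio]
    omega


/-- Median-of-medians selection: at most `⌊(7n+20)/10⌋` elements remain in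
either recursive branch after partitioning by comparison with `m`. -/
theorem kSelection_upper_bounds {α : Type*} [LinearOrder α]
    (n : ℕ) (hn : 7 ≤ n)
    (a : Fin n → α) (ha : Function.Injective a)
    (g : ℕ) (hg : g = (n + 4) / 5)
    (G : ℕ → Finset α)
    (hG : ∀ i < g, G i = (Finset.univ.filter
      (fun j : Fin n => 5 * i ≤ (j : ℕ) ∧ (j : ℕ) < min (5 * (i + 1)) n)).image a)
    (med : ℕ → α)
    (hmed_mem : ∀ i < g, med i ∈ G i)
    (hmed : ∀ i < g, ((G i).filter (fun x => x < med i)).card = (G i).card / 2)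
    (M : Finset α) (hM : M = (Finset.range g).image med)
    (hMcard : M.card = g)
    (m : α) (hm : m ∈ M)
    (hmm : (M.filter (fun x => x < m)).card = g / 2) :
    (Finset.univ.filter (fun j : Fin n => a j < m)).card ≤ (7 * n + 20) / 10 ∧
      (Finset.univ.filter (fun j : Fin n => m ≤ a j)).card ≤ (7 * n + 20) / 10 := by
  subst hg
  set g := (n + 4) / 5 with hg
  have hinj : Set.InjOn med (Finset.range g) := by
    rw [← Finset.card_image_iff, ← hM, hMcard, Finset.card_range]
  have hbelow : ((Finset.range g).filter (fun i => med i < m)).card = g / 2 := by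
    rw [← hmm, hM, Finset.filter_image, Finset.card_image_of_injOn]
    exact hinj.mono (Finset.coe_subset.2 (Finset.filter_subset _ _))
  have hequal : ((Finset.range g).filter (fun i => med i = m)).card = 1 := by
    obtain ⟨i, hi, him⟩ := Finset.mem_image.1 (hM ▸ hm)
    refine Finset.card_eq_one.2 ⟨i, ?_⟩
    ext k
    simp only [Finset.mem_filter, Finset.mem_singleton]
    refine ⟨fun ⟨hk, hkm⟩ => hinj hk hi (hkm.trans him.symm), ?_⟩
    rintro rfl
    exact ⟨hi, him⟩
  have hsize : ∀ i < g, (G i).card = min (5 * (i + 1)) n - 5 * i := fun i hi => by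
    rw [hG i hi, Finset.card_image_of_injective _ ha,
      Fin.card_filter_le_and_lt n _ _ (min_le_right _ _)]
  have hsum : ∀ (Q : α → Prop) [DecidablePred Q],
      (Finset.univ.filter (fun j : Fin n => Q (a j))).card =
        ∑ i ∈ Finset.range g, ((G i).filter Q).card := fun Q _ => by
    rw [Fin.card_filter_eq_sum_blocks]
    refine Finset.sum_congr rfl fun i hi => ?_
    rw [hG i (Finset.mem_range.1 hi), Finset.filter_image, Finset.card_image_of_injective _ ha]
  have hsplit : ∀ i, ((G i).filter (fun x => x < m)).card +
      ((G i).filter (fun x => m ≤ x)).card = (G i).card := fun i => by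
    simpa only [not_lt] using
      Finset.card_filter_add_card_filter_not (s := G i) (fun x => x < m)
  -- The last block has `n - 5 * (g - 1)` elements; its deficit compared with a full block is `δ`.
  set δ := 2 - (n - 5 * (g - 1)) / 2 with hδ
  have hdeficit : ∑ i ∈ Finset.range g, (if i = g - 1 then δ else 0) = δ := by
    rw [Finset.sum_ite_eq' (Finset.range g) (g - 1) fun _ => δ,
      if_pos (Finset.mem_range.2 (by omega))]
  have hlt : ∀ i ∈ Finset.range g, ((G i).filter (fun x => x < m)).card +
      (if i = g - 1 then δ else 0) ≤ 2 + 3 * (if med i < m then 1 else 0) := fun i hi => by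
    have hi := Finset.mem_range.1 hi
    have h₁ := hsize i hi
    have h₂ := hsplit i
    have h₃ := hmed i hi
    rcases lt_or_ge (med i) m with h | h
    · rw [if_pos h]
      split_ifs with hl
      · subst hl; omega
      · omega
    · have h₄ := Finset.card_filter_lt_le_of_le (G i) h
      rw [if_neg h.not_gt]
      split_ifs with hl
      · subst hl; omega
      · omega
  have hge : ∀ i ∈ Finset.range g, ((G i).filter (fun x => m ≤ x)).card +
      (if i = g - 1 then δ else 0) + 3 * (if med i < m then 1 else 0) +
      2 * (if med i = m then 1 else 0) ≤ 5 := fun i hi => by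
    have hi := Finset.mem_range.1 hi
    have h₁ := hsize i hi
    have h₂ := hsplit i
    have h₃ := hmed i hi
    rcases lt_trichotomy (med i) m with h | h | h
    · have h₄ := Finset.card_filter_lt_add_one_le (hmed_mem i hi) h
      rw [if_pos h, if_neg h.ne]
      split_ifs with hl
      · subst hl; omega
      · omega
    · rw [h] at h₃
      rw [if_neg h.not_lt, if_pos h]
      split_ifs with hl
      · subst hl; omega
      · omega
    · rw [if_neg h.not_gt, if_neg h.ne']
      split_ifs with hl
      · subst hl; omega
      · omega
  have hlt_sum := Finset.sum_le_sum hlt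
  have hge_sum := Finset.sum_le_sum hge
  simp only [Finset.sum_add_distrib, ← Finset.mul_sum, hdeficit, Finset.sum_const,
    Finset.card_range, ← Finset.card_filter, hbelow, hequal, smul_eq_mul,
    ← hsum] at hlt_sum hge_sum
  constructor <;> omega
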